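/- Let p, k be positive integers and let S : ℝ → Matrix (Fin p) (Fin p) ℝ, L : ℝ → Matrix (Fin p) (Fin k) ℝ, and τ : ℝ → ℝ be differentiable at t₀ ∈ ℝ, with S(t) invertible and symmetric and (S(t)⁻¹) i i ≠ 0 for all i and all t, and suppose that for all t ∈ ℝ, all i ∈ Fin p and r ∈ Fin k: ∑_{s} S(t) i s · L(t) s r − (τ(t)/((S(t)⁻¹) i i)) · L(t) i r = L(t) i r · ∑_{s} (L(t) s r)². Write σ_{xy} = S(t₀) x y, σ^{xy} = (S(t₀)⁻¹) x y, λ_{it} = L(t₀) i t, τ₀ = τ(t₀), and let σ', λ', τ' denote the derivatives at t₀. Then for all i, r: ∑_{s} λ_{sr} σ'_{is} − τ₀ λ_{ir} ∑_{x,y} (σ^{ix} σ^{iy} / (σ^{ii})²) σ'_{xy} = ∑_{s ≠ i} (2 λ_{ir} λ_{sr} − σ_{is}) λ'_{sr} + (2 λ_{ir}² − σ_{ii} + τ₀/σ^{ii} + ∑_{s} λ_{sr}²) λ'_{ir} + (λ_{ir}/σ^{ii}) τ'. -/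

import Mathlib

open Finset

section MatrixInverse

open scoped Matrix.Norms.Operator

/-- The inverse of a differentiable path of matrices is differentiable wherever it is invertible. -/
theorem hasDerivAt_matrix_inv {n : Type*} [Fintype n] [DecidableEq n]
    {A : ℝ → Matrix n n ℝ} {A' : Matrix n n ℝ} {t : ℝ} (hA : HasDerivAt A A' t)
    (hdet : IsUnit (A t).det) :
    HasDerivAt (fun u => (A u)⁻¹) (-((A t)⁻¹ * A' * (A t)⁻¹)) t := by
  obtain ⟨U, hU⟩ := (Matrix.isUnit_iff_isUnit_det _).2 hdet
  have hinv : HasFDerivAt Ring.inverse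
      (-ContinuousLinearMap.mulLeftRight ℝ (Matrix n n ℝ) ↑U⁻¹ ↑U⁻¹) (A t) :=
    hU ▸ hasFDerivAt_ringInverse U
  have h := hinv.comp_hasDerivAt t hA
  have hU' : (↑U⁻¹ : Matrix n n ℝ) = (A t)⁻¹ := by rw [← hU, Matrix.coe_units_inv]
  simp only [Function.comp_def, neg_apply, ContinuousLinearMap.mulLeftRight_apply, hU'] at h
  simp only [Matrix.nonsing_inv_eq_ringInverse] at h ⊢
  exact h

/-- Entrywise form of the derivative of a differentiable path of inverse matrices. -/
theorem hasDerivAt_matrix_inv_apply {n : Type*} [Fintype n] [DecidableEq n]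
    {A : ℝ → Matrix n n ℝ} {A' : Matrix n n ℝ} {t : ℝ}
    (hA : ∀ x y, HasDerivAt (fun u => A u x y) (A' x y) t) (hdet : IsUnit (A t).det) (i j : n) :
    HasDerivAt (fun u => (A u)⁻¹ i j) (-∑ x, ∑ y, (A t)⁻¹ i x * A' x y * (A t)⁻¹ y j) t := by
  have hA' : HasDerivAt A A' t := hasDerivAt_pi.2 fun x => hasDerivAt_pi.2 (hA x)
  have hentry : -∑ x, ∑ y, (A t)⁻¹ i x * A' x y * (A t)⁻¹ y j
      = (-((A t)⁻¹ * A' * (A t)⁻¹)) i j := by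
    simp only [Matrix.neg_apply, Matrix.mul_apply, Finset.sum_mul]
    rw [Finset.sum_comm]
  rw [hentry]
  exact hasDerivAt_pi.1 (hasDerivAt_pi.1 (hasDerivAt_matrix_inv hA' hdet) i) j

end MatrixInverse

/-- Differential form of the componentwise eigen-equation of image factor analysis,
`∑_s σ_{is}λ_{sr} − (τ/σ^{ii})λ_{ir} = λ_{ir}∑_s λ_{sr}²` with `σ^{ii} = (S⁻¹)_{ii}`,
along differentiable paths of `S`, `L`, `τ`. -/
theorem stmt14 (p k : ℕ) (hp : 0 < p) (hk : 0 < k)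
    (S : ℝ → Matrix (Fin p) (Fin p) ℝ) (L : ℝ → Matrix (Fin p) (Fin k) ℝ) (τ : ℝ → ℝ)
    (t₀ : ℝ)
    (hSinv : ∀ t, IsUnit (S t).det) (hSsymm : ∀ t, (S t).IsSymm)
    (hSne : ∀ t i, (S t)⁻¹ i i ≠ 0)
    (S' : Matrix (Fin p) (Fin p) ℝ) (L' : Matrix (Fin p) (Fin k) ℝ) (τ' : ℝ)
    (hS : ∀ x y, HasDerivAt (fun t => S t x y) (S' x y) t₀)
    (hL : ∀ j u, HasDerivAt (fun t => L t j u) (L' j u) t₀)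
    (hτ : HasDerivAt τ τ' t₀)
    (heq : ∀ (t : ℝ) (i : Fin p) (r : Fin k),
      ∑ s, S t i s * L t s r - (τ t / (S t)⁻¹ i i) * L t i r =
        L t i r * ∑ s, (L t s r) ^ 2)
    (i : Fin p) (r : Fin k) :
    ∑ s, L t₀ s r * S' i s
        - τ t₀ * L t₀ i r
          * ∑ x, ∑ y, ((S t₀)⁻¹ i x * (S t₀)⁻¹ i y / ((S t₀)⁻¹ i i) ^ 2) * S' x y =
      (∑ s ∈ Finset.univ.filter (fun s => s ≠ i),
          (2 * L t₀ i r * L t₀ s r - S t₀ i s) * L' s r)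
        + (2 * L t₀ i r ^ 2 - S t₀ i i + τ t₀ / (S t₀)⁻¹ i i + ∑ s, (L t₀ s r) ^ 2)
            * L' i r
        + (L t₀ i r / (S t₀)⁻¹ i i) * τ' := by
  have hσ : HasDerivAt (fun t => (S t)⁻¹ i i)
      (-∑ x, ∑ y, (S t₀)⁻¹ i x * S' x y * (S t₀)⁻¹ i y) t₀ := by
    have hsymm : ∀ y, (S t₀)⁻¹ y i = (S t₀)⁻¹ i y := fun y => (hSsymm t₀).inv.apply i y
    simpa only [hsymm] using hasDerivAt_matrix_inv_apply hS (hSinv t₀) i i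
  have hlhs := (HasDerivAt.fun_sum (u := Finset.univ)
    fun s _ => (hS i s).fun_mul (hL s r)).fun_sub
      ((hτ.fun_div hσ (hSne t₀ i)).fun_mul (hL i r))
  have hrhs := (hL i r).fun_mul
    (HasDerivAt.fun_sum (u := Finset.univ) fun s _ => (hL s r).fun_pow 2)
  simp only [heq] at hlhs
  have key := hlhs.unique hrhs
  have hquot : ∑ x, ∑ y, ((S t₀)⁻¹ i x * (S t₀)⁻¹ i y / ((S t₀)⁻¹ i i) ^ 2) * S' x y =
      (∑ x, ∑ y, (S t₀)⁻¹ i x * S' x y * (S t₀)⁻¹ i y) / ((S t₀)⁻¹ i i) ^ 2 := by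
    simp only [Finset.sum_div]
    exact Finset.sum_congr rfl fun x _ => Finset.sum_congr rfl fun y _ => by ring
  have hsplit : (∑ s ∈ Finset.univ.filter (fun s => s ≠ i),
        (2 * L t₀ i r * L t₀ s r - S t₀ i s) * L' s r)
      = L t₀ i r * ∑ s, 2 * L t₀ s r * L' s r - ∑ s, S t₀ i s * L' s r
        - (2 * L t₀ i r * L t₀ i r - S t₀ i i) * L' i r := by
    rw [Finset.filter_ne', eq_sub_iff_add_eq, Finset.sum_erase_add _ _ (Finset.mem_univ i),
      Finset.mul_sum, ← Finset.sum_sub_distrib]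
    exact Finset.sum_congr rfl fun s _ => by ring
  have hcomm : ∑ s, L t₀ s r * S' i s = ∑ s, S' i s * L t₀ s r :=
    Finset.sum_congr rfl fun s _ => mul_comm _ _
  rw [hquot, hsplit, hcomm]
  simp only [Finset.sum_add_distrib, Nat.cast_ofNat, Nat.add_one_sub_one, pow_one] at key
  have hne := hSne t₀ i
  have hdiv : (τ' * (S t₀)⁻¹ i i
        - τ t₀ * -∑ x, ∑ y, (S t₀)⁻¹ i x * S' x y * (S t₀)⁻¹ i y) / ((S t₀)⁻¹ i i) ^ 2
      = τ' / (S t₀)⁻¹ i i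
        + τ t₀ * ((∑ x, ∑ y, (S t₀)⁻¹ i x * S' x y * (S t₀)⁻¹ i y) / ((S t₀)⁻¹ i i) ^ 2) := by
    field_simp
    ring
  rw [hdiv] at key
  linear_combination key
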